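/- The group G(A, L') is (free)-by-(abelian)-by-(cyclic): it has a normal subgroup N which is free, such that G/N has a normal abelian subgroup with cyclic quotient. -/

import Mathlib

open Matrix

/-- The rational coordinate vector of an element of `ℤⁿ` (written
multiplicatively). -/
def ratVec {n : ℕ} (v : Multiplicative (Fin n → ℤ)) : Fin n → ℚ :=
  fun i => ((Multiplicative.toAdd v) i : ℚ)

section

universe u

open CategoryTheory SemidirectProduct

/-- For a group `K` acting on `X` through `i : K →* G`, a choice `r` of orbit representatives,
together with elements `κ x` moving the representative of the orbit of `x` to `x`. -/
theorem exists_orbit_representatives {G K X : Type*} [Group G] [Group K] [MulAction G X]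
    (i : K →* G) : ∃ (r : X → X) (κ : X → K), (∀ x, i (κ x) • r x = x) ∧
      ∀ k x, r (i k • x) = r x := by
  let : MulAction K X := MulAction.compHom X i
  have h (x : X) : ∃ k : K, k • (Quotient.mk (MulAction.orbitRel K X) x).out = x :=
    (MulAction.orbitRel K X).symm (Quotient.mk_out x)
  choose κ hκ using h
  exact ⟨fun x ↦ (Quotient.mk (MulAction.orbitRel K X) x).out, κ, hκ, fun k x ↦
    congrArg Quotient.out (Quotient.sound ⟨k, rfl⟩)⟩

theorem mulAutArrow_apply_eq {G X H : Type*} [Group G] [MulAction G X] [Monoid H] (g : G)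
    (f : X → H) (x : X) : mulAutArrow g f x = f (g⁻¹ • x) := rfl

/-- A subgroup is free as soon as the action groupoid of its coset space is. -/
theorem isFreeGroup_of_isFreeGroupoid_quotient {G : Type u} [Group G] (N : Subgroup G)
    [hG : IsFreeGroupoid (ActionCategory G (G ⧸ N))] : IsFreeGroup N :=
  have h : IsConnected (ActionCategory G (G ⧸ N)) := inferInstance
  @IsFreeGroup.ofMulEquiv _ (_) (@IsFreeGroupoid.endIsFreeOfConnectedFree _ _ h hG _) _ _
    (ActionCategory.endMulEquivSubgroup N)

namespace HNNExtension

variable {K : Type*} [Group K] {A B : Subgroup K} {φ : A ≃* B} {X H : Type*} [Group H]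
  [MulAction (HNNExtension K A B φ) X]

/-- Suppose `K` acts freely on `X`, let `r` and `s` choose representatives of the `K`-orbits and of
the `B`-orbits, and let `κ x` move `r x` to `x`. A section of `(X → H) ⋊ HNNExtension K A B φ` over
`HNNExtension K A B φ` is then uniquely determined by arbitrary values along the elements `κ x`
with `x` not a representative, and of the stable letter at the representatives of `B`-orbits. -/
theorem existsUnique_lift_semidirectProduct
    (hfree : ∀ (k : K) (x : X), (of k : HNNExtension K A B φ) • x = x → k = 1)
    {r s : X → X} {κ : X → K} {β : X → B}
    (hκ : ∀ x, (of (κ x) : HNNExtension K A B φ) • r x = x)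
    (hr : ∀ (k : K) x, r ((of k : HNNExtension K A B φ) • x) = r x)
    (hβ : ∀ x, (of (β x : K) : HNNExtension K A B φ) • s x = x)
    (hs : ∀ (b : B) x, s ((of (b : K) : HNNExtension K A B φ) • x) = s x)
    (h τ : X → H) (hh : ∀ x, h (r x) = 1) :
    ∃! F : HNNExtension K A B φ →* (X → H) ⋊[mulAutArrow] HNNExtension K A B φ,
      rightHom.comp F = MonoidHom.id _ ∧ (∀ x, (F (of (κ x))).left x = h x) ∧
        ∀ x, s x = x → (F t).left x = τ x := by
  have hκ' (x) : (of (κ x) : HNNExtension K A B φ)⁻¹ • x = r x := by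
    rw [inv_smul_eq_iff, hκ]
  have hβ' (x) : (of (β x : K) : HNNExtension K A B φ)⁻¹ • x = s x := by
    rw [inv_smul_eq_iff, hβ]
  have hss (x) : s (s x) = s x := by rw [← hs (β x) (s x), hβ]
  have hκmul (k : K) (x : X) : κ ((of k : HNNExtension K A B φ) • x) = k * κ x := by
    rw [← mul_inv_eq_one]
    apply hfree _ ((of k : HNNExtension K A B φ) • x)
    have h1 := hκ ((of k : HNNExtension K A B φ) • x)
    rw [hr] at h1
    conv_rhs => rw [← h1]
    rw [map_mul, mul_smul]
    congr 1
    rw [map_inv, inv_smul_eq_iff, map_mul, mul_smul, hκ]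
  let w : X → H := fun x ↦ h x * ((h (s x))⁻¹ * τ (s x) * h ((t : HNNExtension K A B φ)⁻¹ • s x)) *
    (h ((t : HNNExtension K A B φ)⁻¹ • x))⁻¹
  let f : K →* (X → H) ⋊[mulAutArrow] HNNExtension K A B φ :=
    { toFun k := ⟨fun x ↦ h x * (h ((of k : HNNExtension K A B φ)⁻¹ • x))⁻¹, of k⟩
      map_one' := by
        ext <;> simp
      map_mul' k l := by
        ext x
        · simp [-mulAutArrow_apply_apply, mulAutArrow_apply_eq, mul_smul, mul_assoc]
        · simp }
  refine ⟨lift f ⟨w, t⟩ ?_, ⟨?_, ?_, ?_⟩, ?_⟩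
  · intro a
    ext x
    · have hsa : s ((of (φ a : K) : HNNExtension K A B φ)⁻¹ • x) = s x := by
        simpa using hs (φ a)⁻¹ x
      have ha : (t : HNNExtension K A B φ)⁻¹ • (of (φ a : K) : HNNExtension K A B φ)⁻¹ • x =
          (of (a : K) : HNNExtension K A B φ)⁻¹ • (t : HNNExtension K A B φ)⁻¹ • x := by
        rw [← mul_smul, ← mul_smul, ← _root_.mul_inv_rev, ← _root_.mul_inv_rev, t_mul_of]
      simp [f, w, -mulAutArrow_apply_apply, mulAutArrow_apply_eq, hsa, ha, mul_assoc]
    · simp [f, t_mul_of]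
  · ext <;> simp [f]
  · intro x
    simp [f, hκ', hh]
  · intro x hx
    simp [w, hx, mul_assoc]
  · rintro F ⟨hF, h1, h2⟩
    have hF' (g) : (F g).right = g := DFunLike.congr_fun hF g
    have hmul (g g') (x : X) : (F (g * g')).left x = (F g).left x * (F g').left (g⁻¹ • x) := by
      rw [map_mul, mul_left, hF']
      rfl
    have hof (k : K) (x : X) : (F (of k)).left x =
        h x * (h ((of k : HNNExtension K A B φ)⁻¹ • x))⁻¹ := by
      rw [eq_mul_inv_iff_mul_eq, ← h1, ← hmul, ← map_mul, ← hκmul, smul_inv_smul, h1]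
    ext x
    · simp [f, hof]
    · simp [f, hF']
    · have e1 := hmul (of (β x : K)) t x
      rw [of_mul_t, hmul, hβ', h2 _ (hss x), hof, hof, hβ', ← mul_smul,
        ← _root_.mul_inv_rev, ← of_mul_t, _root_.mul_inv_rev, mul_smul, hβ',
        ← eq_mul_inv_iff_mul_eq] at e1
      simp [w, e1, mul_assoc]
    · simp [hF']

/-- If the base group acts freely on `X`, then the action groupoid of the HNN extension on `X` is
free. -/
theorem nonempty_isFreeGroupoid_actionCategory {K : Type u} [Group K] {A B : Subgroup K}
    {φ : A ≃* B} {X : Type u} [MulAction (HNNExtension K A B φ) X]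
    (hfree : ∀ (k : K) (x : X), (of k : HNNExtension K A B φ) • x = x → k = 1) :
    Nonempty (IsFreeGroupoid (ActionCategory (HNNExtension K A B φ) X)) := by
  classical
  obtain ⟨r, κ, hκ, hr⟩ := exists_orbit_representatives (X := X)
    (of : K →* HNNExtension K A B φ)
  obtain ⟨s, β, hβ, hs⟩ := exists_orbit_representatives (X := X)
    ((of : K →* HNNExtension K A B φ).comp B.subtype)
  have hrr (x) : r (r x) = r x := by rw [← hr (κ x) (r x), hκ]
  refine ⟨{
    quiverGenerators := ⟨fun a b ↦
      {_e : PUnit.{u + 1} // r b.back ≠ b.back ∧ a.back = r b.back} ⊕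
      {_e : PUnit.{u + 1} // s b.back = b.back ∧ a.back = (t : HNNExtension K A B φ)⁻¹ • b.back}⟩
    of := fun {a b} e ↦ Sum.elim
      (fun e ↦ ⟨of (κ b.back), by
        have := hκ b.back
        rwa [← e.2.2] at this⟩)
      (fun e ↦ ⟨t, by
        have := smul_inv_smul (t : HNNExtension K A B φ) b.back
        rwa [← e.2.2] at this⟩) e
    unique_lift := ?_ }⟩
  intro H _ f
  obtain ⟨F, ⟨hF, hFκ, hFt⟩, huniq⟩ := existsUnique_lift_semidirectProduct hfree hκ hr hβ hs
    (fun x ↦ if hx : r x ≠ x then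
      @f (⟨(), r x⟩ : ActionCategory _ X) (⟨(), x⟩ : ActionCategory _ X)
        (.inl ⟨⟨⟩, hx, rfl⟩) else 1)
    (fun x ↦ if hx : s x = x then
      @f (⟨(), (t : HNNExtension K A B φ)⁻¹ • x⟩ : ActionCategory _ X)
        (⟨(), x⟩ : ActionCategory _ X) (.inr ⟨⟨⟩, hx, rfl⟩) else 1)
    (fun x ↦ by simp [hrr])
  refine ⟨ActionCategory.uncurry F (DFunLike.congr_fun hF), ?_, ?_⟩
  · rintro ⟨⟨⟩, a : X⟩ ⟨⟨⟩, b : X⟩ (⟨⟨⟩, hb, rfl : a = r b⟩ | ⟨⟨⟩, hb, rfl : a = _ • b⟩)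
    · exact (hFκ b).trans (dif_pos hb)
    · exact (hFt b hb).trans (dif_pos hb)
  · intro E hE
    have hEF : ActionCategory.curry E = F := by
      have hmap (a b : ActionCategory (HNNExtension K A B φ) X) (e : a ⟶ b) :
          E.map e = (ActionCategory.curry E e.val).left b.back := by
        cases e using ActionCategory.cases
        rfl
      refine huniq _ ⟨MonoidHom.ext fun _ ↦ rfl, fun x ↦ ?_, fun x hx ↦ ?_⟩
      · split_ifs with hx
        · exact (hmap _ _ _).symm.trans (hE (⟨(), r x⟩ : ActionCategory _ X)
            (⟨(), x⟩ : ActionCategory _ X) (.inl ⟨⟨⟩, hx, rfl⟩))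
        · have hκx : κ x = 1 := hfree _ x (by
            have hx' := hκ x
            rwa [not_not.1 hx] at hx')
          rw [hκx, map_one, map_one]
          rfl
      · rw [dif_pos hx]
        exact (hmap _ _ _).symm.trans (hE
          (⟨(), (t : HNNExtension K A B φ)⁻¹ • x⟩ : ActionCategory _ X)
          (⟨(), x⟩ : ActionCategory _ X) (.inr ⟨⟨⟩, hx, rfl⟩))
    subst hEF
    apply Functor.hext
    · intro
      apply Unit.ext
    · refine ActionCategory.cases fun _ _ ↦ ?_
      rfl

/-- A normal subgroup of an HNN extension meeting the base group trivially is free. -/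
theorem isFreeGroup_of_normal_of_disjoint {K : Type u} [Group K] {A B : Subgroup K}
    {φ : A ≃* B} (N : Subgroup (HNNExtension K A B φ)) [N.Normal]
    (hN : ∀ k : K, (of k : HNNExtension K A B φ) ∈ N → k = 1) : IsFreeGroup N := by
  obtain ⟨_⟩ := nonempty_isFreeGroupoid_actionCategory (K := K) (A := A) (B := B) (φ := φ)
    (X := HNNExtension K A B φ ⧸ N) (by
      intro k x
      induction x using QuotientGroup.induction_on with | H g =>
      intro h
      apply hN
      rw [← QuotientGroup.eq_one_iff]
      simpa using h)
  exact isFreeGroup_of_isFreeGroupoid_quotient N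

/-- If the base group embeds in an abelian group `V` so that `φ` is the restriction of an
automorphism of `V`, then the HNN extension is free-by-abelian-by-cyclic: the kernel of its map to
`V ⋊ ℤ` is free. -/
theorem exists_free_by_abelian_by_cyclic {K : Type u} [Group K] {A B : Subgroup K}
    {φ : A ≃* B} {V : Type*} [CommGroup V] (α : MulAut V) (i : K →* V)
    (hi : Function.Injective i) (hα : ∀ a : A, i (φ a : K) = α (i a)) :
    ∃ N M : Subgroup (HNNExtension K A B φ),
      N.Normal ∧ IsFreeGroup N ∧ N ≤ M ∧ M.Normal ∧
      (∀ a b : HNNExtension K A B φ, a ∈ M → b ∈ M → a * b * a⁻¹ * b⁻¹ ∈ N) ∧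
      ∃ x : HNNExtension K A B φ, ∀ g : HNNExtension K A B φ, ∃ k : ℤ, g * (x ^ k)⁻¹ ∈ M := by
  let P : HNNExtension K A B φ →* V ⋊[zpowersHom _ α] Multiplicative ℤ :=
    lift (inl.comp i) (inr (Multiplicative.ofAdd 1)) fun a ↦ by
      ext <;> simp [hα]
  refine ⟨P.ker, (rightHom.comp P).ker, inferInstance, ?_, ?_, inferInstance, ?_, t, ?_⟩
  · apply isFreeGroup_of_normal_of_disjoint
    intro k hk
    apply hi
    apply inl_injective (φ := zpowersHom _ α)
    simpa [P] using hk
  · intro g hg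
    simp_all [MonoidHom.mem_ker]
  · intro a b ha hb
    simp only [MonoidHom.mem_ker, MonoidHom.comp_apply] at ha hb ⊢
    rw [← MonoidHom.mem_ker, ← range_inl_eq_ker_rightHom] at ha hb
    obtain ⟨v, hv⟩ := ha
    obtain ⟨w, hw⟩ := hb
    simp only [map_mul, map_inv, ← hv, ← hw]
    rw [← map_mul, mul_comm, map_mul]
    group
  · intro g
    refine ⟨(rightHom (P g)).toAdd, ?_⟩
    have ht : rightHom (P t) = Multiplicative.ofAdd 1 := by simp [P]
    rw [MonoidHom.mem_ker, MonoidHom.comp_apply, map_mul, map_inv, map_zpow, map_mul, map_inv,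
      map_zpow, ht, ← ofAdd_zsmul]
    simp

end HNNExtension

end

/-- The commensurating HNN-extension `G(A, L')` of `L = ℤⁿ`, where the stable
letter conjugates the finite-index subgroup `L'` to `L'' = A·L'` via
multiplication by the matrix `A ∈ GL(n, ℚ)`, is (free)-by-(abelian)-by-(cyclic):
it has a free normal subgroup `N` and a normal subgroup `M ⊇ N` such that `M/N`
is abelian and `G/M` is cyclic. -/
theorem GAL'_free_by_abelian_by_cyclic (n : ℕ)
    (A : Matrix (Fin n) (Fin n) ℚ) (hA : IsUnit A.det)
    (L' L'' : Subgroup (Multiplicative (Fin n → ℤ)))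
    (hfi : L'.index ≠ 0)
    (φ : L' ≃* L'')
    (hφ : ∀ v : L', ratVec ((φ v : L'') : Multiplicative (Fin n → ℤ)) =
      A.mulVec (ratVec ((v : Multiplicative (Fin n → ℤ))))) :
    ∃ N M : Subgroup (HNNExtension (Multiplicative (Fin n → ℤ)) L' L'' φ),
      N.Normal ∧ IsFreeGroup N ∧ N ≤ M ∧ M.Normal ∧
      (∀ a b : HNNExtension (Multiplicative (Fin n → ℤ)) L' L'' φ,
        a ∈ M → b ∈ M → a * b * a⁻¹ * b⁻¹ ∈ N) ∧
      ∃ x : HNNExtension (Multiplicative (Fin n → ℤ)) L' L'' φ,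
        ∀ g : HNNExtension (Multiplicative (Fin n → ℤ)) L' L'' φ,
          ∃ k : ℤ, g * (x ^ k)⁻¹ ∈ M := by
  let α : MulAut (Multiplicative (Fin n → ℚ)) :=
    AddEquiv.toMultiplicative (A.toLinearEquiv' (A.invertibleOfIsUnitDet hA)).toAddEquiv
  let i : Multiplicative (Fin n → ℤ) →* Multiplicative (Fin n → ℚ) :=
    { toFun v := .ofAdd (ratVec v)
      map_one' := by
        ext; simp [ratVec]
      map_mul' v w := by
        ext; simp [ratVec] }
  refine HNNExtension.exists_free_by_abelian_by_cyclic α i (fun v w h ↦ ?_) fun a ↦ ?_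
  · funext j
    exact Int.cast_injective (α := ℚ) (congrFun h j)
  · exact congrArg Multiplicative.ofAdd (hφ a)
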